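/- Let α > 1 and let f belong to the Müntz class M_α, and suppose additionally that f*(1) = ∫₀^∞ f(y) dy = 0. Then for every x > 0 and every σ with 0 < σ < 1 the Möbius transformation has the representation (Θf)(x) = (1/(2πi)) ∫_{σ−i∞}^{σ+i∞} ζ(s) f*(s) x^{−s} ds. -/

import Mathlib

open MeasureTheory Filter Asymptotics Set Complex

noncomputable section

/-- The Mellin transform of `f`. -/
def mellinT (f : ℝ → ℂ) (s : ℂ) : ℂ := ∫ x in Ioi (0:ℝ), (x : ℂ) ^ (s - 1) * f x

/-- The Müntz class `M_α`. -/
def MuntzClass (α : ℝ) (f : ℝ → ℂ) : Prop :=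
  ContDiffOn ℝ 2 f (Ici 0) ∧
  ∀ j : ℕ, j ≤ 2 →
    (iteratedDerivWithin j f (Ici 0)) =O[atTop] fun x : ℝ => x ^ (-(α + (j : ℝ)))

/-- The Möbius transformation `(Θf)(x) = ∑ f(nx)`. -/
def thetaOp (f : ℝ → ℂ) (x : ℝ) : ℂ := ∑' n : ℕ, f ((n + 1 : ℝ) * x)

/-- The Müntz operator. -/
def muntzOp (f : ℝ → ℂ) (x : ℝ) : ℂ :=
  thetaOp f x - (x : ℂ)⁻¹ * ∫ y in Ioi (0:ℝ), f y

/-- `(1/(2πi)) ∫_{σ-i∞}^{σ+i∞} g(s) ds`. -/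
def lineIntegral (g : ℂ → ℂ) (σ : ℝ) : ℂ :=
  (2 * Real.pi)⁻¹ • ∫ t : ℝ, g (σ + t * Complex.I)

/-- The Fourier cosine transform. -/
def fourierCos (f : ℝ → ℂ) (x : ℝ) : ℂ :=
  (Real.sqrt (2 / Real.pi) : ℂ) * ∫ t in Ioi (0:ℝ), f t * (Real.cos (x * t) : ℂ)

/-- The reduced Möbius operator. -/
def thetaHat (f : ℝ → ℂ) (x : ℝ) : ℂ :=
  ∑' n : ℕ, ((|ArithmeticFunction.moebius (n + 1)| : ℤ) : ℂ) * f ((n + 1 : ℝ) * x)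

/-- The Voronoi operator. -/
def voronoiOp (f : ℝ → ℂ) (x : ℝ) : ℂ :=
  (∑' n : ℕ, ((n + 1 : ℕ).divisors.card : ℂ) * f ((n + 1 : ℝ) * x)) -
    ∫ y in Ioi (0:ℝ), f (x * y) *
      ((Real.log y + 2 * Real.eulerMascheroniConstant : ℝ) : ℂ)

open scoped Topology

/-- fractional part as a complex number -/
def fr (u : ℝ) : ℂ := ((Int.fract u : ℝ) : ℂ)

lemma fr_meas : Measurable fr := by
  unfold fr
  exact Complex.measurable_ofReal.comp measurable_fract

lemma fr_norm (u : ℝ) : ‖fr u‖ ≤ 1 := by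
  unfold fr
  rw [Complex.norm_real, Real.norm_eq_abs, abs_of_nonneg (Int.fract_nonneg u)]
  exact (Int.fract_lt_one u).le

lemma fr_mul_int {g : ℝ → ℂ} {s : Set ℝ} (hg : IntegrableOn g s) :
    IntegrableOn (fun u => fr u * g u) s :=
  Integrable.bdd_mul hg fr_meas.aestronglyMeasurable (c := 1) (ae_of_all _ fr_norm)

lemma fr_ibp (n : ℕ) (g g' : ℝ → ℂ) (hg : ContinuousOn g (Icc n (n+1)))
    (hd : ∀ u ∈ Ioo (n:ℝ) (n+1), HasDerivAt g (g' u) u)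
    (hg' : ContinuousOn g' (Icc n (n+1))) :
    ∫ u in (n:ℝ)..(n+1), fr u * g' u = g (n+1) - ∫ u in (n:ℝ)..(n+1), g u := by
  have hle : (n:ℝ) ≤ n + 1 := by linarith
  have h1 : ∫ u in (n:ℝ)..(n+1), fr u * g' u = ∫ u in (n:ℝ)..(n+1), ((u:ℂ) - n) * g' u := by
    rw [intervalIntegral.integral_of_le hle, intervalIntegral.integral_of_le hle,
      ← integral_Ico_eq_integral_Ioc, ← integral_Ico_eq_integral_Ioc]
    refine setIntegral_congr_fun measurableSet_Ico fun u hu => ?_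
    have : Int.fract u = u - n := by
      rw [Int.fract_eq_iff]
      refine ⟨by linarith [hu.1], by linarith [hu.2], n, by simp⟩
    simp only [fr, this]
    push_cast; rfl
  rw [h1]
  rw [intervalIntegral.integral_mul_deriv_eq_deriv_mul_of_hasDeriv_right (u := fun u : ℝ => (u:ℂ) - n)
    (u' := fun _ => 1) (v := g)]
  · simp
  · fun_prop
  · rwa [uIcc_of_le hle]
  · intro x hx
    exact ((Complex.ofRealCLM.hasDerivAt (x := x)).sub_const _).hasDerivWithinAt
  · intro x hx
    rw [min_eq_left hle, max_eq_right hle] at hx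
    exact (hd x hx).hasDerivWithinAt
  · simp
  · apply ContinuousOn.intervalIntegrable
    rwa [uIcc_of_le hle]

lemma fr_sum (M : ℕ) (g g' : ℝ → ℂ) (hg : ContinuousOn g (Ici M))
    (hd : ∀ u ∈ Ioi (M:ℝ), HasDerivAt g (g' u) u)
    (hg' : ContinuousOn g' (Ici M)) 
    (hi : IntegrableOn g (Ioi M)) (hi' : IntegrableOn g' (Ioi M))
    (hs : Summable fun k : ℕ => g (M + k + 1)) :
    ∑' k : ℕ, g (M + k + 1) = (∫ u in Ioi (M:ℝ), fr u * g' u) + ∫ u in Ioi (M:ℝ), g u := by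
  have key : ∀ N : ℕ, ∑ k ∈ Finset.range N, g (M + k + 1) =
      (∫ u in (M:ℝ)..((M + N : ℕ):ℝ), fr u * g' u) + ∫ u in (M:ℝ)..((M+N:ℕ):ℝ), g u := by
    have II : ∀ {h : ℝ → ℂ}, IntegrableOn h (Ioi M) → ∀ a b : ℝ, M ≤ a → M ≤ b →
        IntervalIntegrable h volume a b := by
      intro h hh a b ha hb
      refine ⟨hh.mono_set ?_, hh.mono_set ?_⟩
      · intro x hx; exact lt_of_le_of_lt ha hx.1
      · intro x hx; exact lt_of_le_of_lt hb hx.1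
    intro N
    induction N with
    | zero => simp
    | succ N ih =>
      have e : ((M + (N+1) : ℕ):ℝ) = ((M + N : ℕ):ℝ) + 1 := by push_cast; ring
      have hMN : (M:ℝ) ≤ ((M+N:ℕ):ℝ) := by push_cast; linarith [(Nat.cast_nonneg N : (0:ℝ) ≤ N)]
      have sub : Icc ((M+N:ℕ):ℝ) ((M+N:ℕ)+1) ⊆ Ici (M:ℝ) := fun x hx => hMN.trans hx.1
      rw [Finset.sum_range_succ, ih, e,
        ← intervalIntegral.integral_add_adjacent_intervals
          (II (fr_mul_int hi') M (M+N:ℕ) le_rfl hMN) (II (fr_mul_int hi') (M+N:ℕ) ((M+N:ℕ)+1) hMN (by linarith)),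
        ← intervalIntegral.integral_add_adjacent_intervals
          (II hi M (M+N:ℕ) le_rfl hMN) (II hi (M+N:ℕ) ((M+N:ℕ)+1) hMN (by linarith)),
        fr_ibp (M+N) g g' (hg.mono sub) (fun u hu => hd u (lt_of_le_of_lt hMN hu.1)) (hg'.mono sub)]
      push_cast
      ring
  have t1 := hs.hasSum.tendsto_sum_nat
  have hT : Tendsto (fun N : ℕ => ((M + N : ℕ):ℝ)) atTop atTop := by
    refine tendsto_natCast_atTop_atTop.comp ?_
    exact tendsto_atTop_mono (fun n => Nat.le_add_left n M) tendsto_id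
  have t2 := (intervalIntegral_tendsto_integral_Ioi (M:ℝ) (fr_mul_int hi') hT).add
    (intervalIntegral_tendsto_integral_Ioi (M:ℝ) hi hT)
  refine tendsto_nhds_unique t1 (t2.congr fun N => (key N).symm)

/-- ∫₁^∞ {u} u^{-s-1} du -/
def Jf (s : ℂ) : ℂ := ∫ u in Ioi (1:ℝ), fr u * (u:ℂ)^(-s-1)

lemma hasDeriv_cpow_neg (s : ℂ) {u : ℝ} (hu : 0 < u) :
    HasDerivAt (fun u : ℝ => (u:ℂ)^(-s)) (-s * (u:ℂ)^(-s-1)) u := by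
  have := (hasDerivAt_id (u:ℂ)).cpow_const (c := -s) (Or.inl (by simpa using hu))
  simpa using this.comp_ofReal

lemma cont_cpow (c : ℂ) : ContinuousOn (fun u : ℝ => (u:ℂ)^c) (Ioi 0) := by
  intro u hu
  refine ContinuousAt.continuousWithinAt ?_
  exact (Complex.continuous_ofReal.continuousAt).cpow continuousAt_const (Or.inl (by simpa using hu))

lemma zeta0_eq_of_one_lt {s : ℂ} (hs : 1 < s.re) : riemannZeta₀ s = 1 - s * Jf s := by
  have hs1 : s ≠ 1 := by rintro rfl; simp at hs
  have hs1' : s - 1 ≠ 0 := sub_ne_zero.mpr hs1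
  have hz := zeta_eq_tsum_one_div_nat_add_one_cpow hs
  have hsum : Summable fun n : ℕ => 1 / ((n:ℂ) + 1)^s := by
    have := (summable_nat_add_iff 1).mpr (Complex.summable_one_div_nat_cpow.mpr hs)
    simpa using this
  rw [hsum.tsum_eq_zero_add] at hz
  have hsub : Ici (1:ℝ) ⊆ Ioi 0 := fun x hx => lt_of_lt_of_le (one_pos : (0:ℝ) < 1) (mem_Ici.mp hx)
  have conv : ∀ k : ℕ, 1 / (((k+1 : ℕ):ℂ) + 1)^s = (fun u : ℝ => (u:ℂ)^(-s)) ((1:ℕ) + k + 1) := by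
    intro k
    simp only
    rw [Complex.cpow_neg, one_div]
    push_cast
    rw [add_comm (1:ℂ) k]
  have hi : IntegrableOn (fun u : ℝ => (u:ℂ)^(-s)) (Ioi 1) := 
    integrableOn_Ioi_cpow_of_lt (by simpa using hs) one_pos
  have hi' : IntegrableOn (fun u : ℝ => -s * (u:ℂ)^(-s-1)) (Ioi 1) := 
    (integrableOn_Ioi_cpow_of_lt (by simp; linarith) one_pos).const_mul _
  have main := fr_sum 1 (fun u : ℝ => (u:ℂ)^(-s)) (fun u : ℝ => -s * (u:ℂ)^(-s-1))
    ((cont_cpow _).mono (by rw [Nat.cast_one]; exact hsub))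
    (fun u hu => hasDeriv_cpow_neg s (by simp at hu; linarith))
    (((cont_cpow _).mono (by rw [Nat.cast_one]; exact hsub)).const_mul _ ) (by simpa using hi) (by simpa using hi')
    (by
      have := (summable_nat_add_iff 1).mpr hsum
      exact this.congr fun k => conv k)
  rw [tsum_congr conv, main] at hz
  have e1 : ∫ u in Ioi ((1:ℕ):ℝ), (u:ℂ)^(-s) = (s-1)⁻¹ := by
    rw [Nat.cast_one, integral_Ioi_cpow_of_lt (by simpa using hs) one_pos]
    simp
    rw [show -s + 1 = -(s-1) by ring, div_neg, neg_div, neg_neg, one_div]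
  have e2 : ∫ u in Ioi ((1:ℕ):ℝ), fr u * (-s * (u:ℂ)^(-s-1)) = -s * Jf s := by
    rw [Jf, ← integral_const_mul, Nat.cast_one]
    congr 1; ext u; ring
  rw [e1, e2, riemannZeta_eq_inv_sub_add hs1] at hz
  have : riemannZeta₀ s = (s-1)⁻¹ + riemannZeta₀ s - (s-1)⁻¹ := by ring
  rw [this, hz]
  simp; ring

lemma Jf_eq_mellin (s : ℂ) : Jf s = mellin ((Ioi (1:ℝ)).indicator fr) (-s) := by
  unfold Jf mellin
  have : ∀ u : ℝ, (u:ℂ)^(-s-1) • (Ioi (1:ℝ)).indicator fr u =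
     (Ioi (1:ℝ)).indicator (fun u : ℝ => fr u * (u:ℂ)^(-s-1)) u := by
    intro u
    by_cases h : u ∈ Ioi (1:ℝ) 
    · simp only [indicator_of_mem h, smul_eq_mul]; ring
    · simp [indicator_of_notMem h]
  simp_rw [this]
  rw [setIntegral_indicator measurableSet_Ioi]
  congr 2
  rw [Ioi_inter_Ioi]; simp

lemma Jf_diff {s : ℂ} (hs : 0 < s.re) : DifferentiableAt ℂ Jf s := by
  have : Jf = (mellin ((Ioi (1:ℝ)).indicator fr)) ∘ (fun s => -s) := by
    ext s; exact Jf_eq_mellin s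
  rw [this]
  refine DifferentiableAt.comp s ?_ (by fun_prop)
  have hb : ∀ u, ‖(Ioi (1:ℝ)).indicator fr u‖ ≤ 1 := fun u => 
    (norm_indicator_le_norm_self _ _).trans (fr_norm u)
  refine mellin_differentiableAt_of_isBigO_rpow (a := 0) (b := -s.re - 1) ?_ ?_ (by simpa) ?_ (by simp)
  · refine LocallyIntegrable.locallyIntegrableOn ?_ _
    refine (locallyIntegrable_const (1:ℝ)).mono (fr_meas.indicator measurableSet_Ioi).aestronglyMeasurable ?_
    exact ae_of_all _ fun u => by simpa using hb u
  · refine IsBigO.of_bound 1 (Eventually.of_forall fun u => by simpa using hb u)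
  · refine IsBigO.of_bound 1 ?_
    filter_upwards [nhdsWithin_le_nhds (Iio_mem_nhds (one_pos : (0:ℝ) < 1))] with u hu
    rw [indicator_of_notMem (by simp at hu ⊢; exact hu.le)]
    simp

lemma zeta0_eq {s : ℂ} (hs : 0 < s.re) : riemannZeta₀ s = 1 - s * Jf s := by
  have ho : IsOpen {s : ℂ | 0 < s.re} := isOpen_lt continuous_const Complex.continuous_re
  have hc : IsPreconnected {s : ℂ | 0 < s.re} := (convex_halfSpace_re_gt 0).isPreconnected
  have a1 : AnalyticOnNhd ℂ riemannZeta₀ {s : ℂ | 0 < s.re} := 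
    differentiable_riemannZeta₀.differentiableOn.analyticOnNhd ho
  have a2 : AnalyticOnNhd ℂ (fun s => 1 - s * Jf s) {s : ℂ | 0 < s.re} := by
    refine DifferentiableOn.analyticOnNhd ?_ ho
    intro s hs
    have := Jf_diff hs
    exact DifferentiableAt.differentiableWithinAt (by fun_prop)
  refine a1.eqOn_of_preconnected_of_eventuallyEq a2 hc (z₀ := 2) (by simp) ?_ hs
  have : {s : ℂ | 1 < s.re} ∈ 𝓝 (2:ℂ) := 
    (isOpen_lt continuous_const Complex.continuous_re).mem_nhds (by simp)
  filter_upwards [this] with s hs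
  exact zeta0_eq_of_one_lt hs

/-- ∫₀^∞ {u} u^{-s-1} du -/
def Kf (s : ℂ) : ℂ := ∫ u in Ioi (0:ℝ), fr u * (u:ℂ)^(-s-1)

lemma fr_of_lt {u : ℝ} (h : u ∈ Ioo (0:ℝ) 1) : fr u = u := by
  simp only [fr]
  rw [Int.fract_eq_self.mpr ⟨h.1.le, h.2⟩]

lemma fr_cpow_eqOn (s : ℂ) : EqOn (fun u : ℝ => fr u * (u:ℂ)^(-s-1)) (fun u : ℝ => (u:ℂ)^(-s)) (Ioo 0 1) := by
  intro u hu
  have h0 : (u:ℂ) ≠ 0 := by exact_mod_cast hu.1.ne'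
  simp only
  rw [fr_of_lt hu, Complex.cpow_sub _ _ h0, Complex.cpow_one]
  field_simp

lemma fr_int_Ioi1 {s : ℂ} (h0 : 0 < s.re) : 
    IntegrableOn (fun u : ℝ => fr u * (u:ℂ)^(-s-1)) (Ioi 1) :=
  fr_mul_int (integrableOn_Ioi_cpow_of_lt (by simp; linarith) one_pos)

lemma fr_int_Ioc {s : ℂ} (h1 : s.re < 1) : 
    IntegrableOn (fun u : ℝ => fr u * (u:ℂ)^(-s-1)) (Ioc 0 1) := by
  rw [integrableOn_Ioc_iff_integrableOn_Ioo, integrableOn_congr_fun (fr_cpow_eqOn s) measurableSet_Ioo,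
    ← integrableOn_Ioc_iff_integrableOn_Ioo, ← intervalIntegrable_iff_integrableOn_Ioc_of_le zero_le_one]
  exact intervalIntegral.intervalIntegrable_cpow' (by simp; linarith)

lemma fr_int {s : ℂ} (h0 : 0 < s.re) (h1 : s.re < 1) : 
    IntegrableOn (fun u : ℝ => fr u * (u:ℂ)^(-s-1)) (Ioi 0) := by
  rw [← Ioc_union_Ioi_eq_Ioi (zero_le_one (α := ℝ))]
  exact (fr_int_Ioc h1).union (fr_int_Ioi1 h0)

lemma Kf_eq {s : ℂ} (h0 : 0 < s.re) (h1 : s.re < 1) : Kf s = (1-s)⁻¹ + Jf s := by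
  unfold Kf Jf
  rw [← Ioc_union_Ioi_eq_Ioi (zero_le_one (α := ℝ)),
    setIntegral_union (by simp [disjoint_left]) measurableSet_Ioi (fr_int_Ioc h1) (fr_int_Ioi1 h0)]
  congr 1
  rw [integral_Ioc_eq_integral_Ioo, setIntegral_congr_fun measurableSet_Ioo (fr_cpow_eqOn s),
    ← integral_Ioc_eq_integral_Ioo, ← intervalIntegral.integral_of_le zero_le_one,
    integral_cpow (Or.inl (by simp; linarith))]
  have : -s + 1 ≠ 0 := by
    intro h
    have := congrArg Complex.re h
    simp at this; linarith
  simp [Complex.zero_cpow this]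
  ring_nf

lemma zeta_eq {s : ℂ} (h0 : 0 < s.re) (h1 : s.re < 1) : riemannZeta s = -s * Kf s := by
  have hs1 : s ≠ 1 := by rintro rfl; simp at h1
  rw [riemannZeta_eq_inv_sub_add hs1, zeta0_eq h0, Kf_eq h0 h1]
  have : s - 1 ≠ 0 := sub_ne_zero.mpr hs1
  have h2 : 1 - s ≠ 0 := sub_ne_zero.mpr hs1.symm
  rw [← neg_sub 1 s, inv_neg]
  field_simp
  ring

lemma norm_cpow_real {u : ℝ} (hu : 0 < u) (c : ℂ) : ‖(u:ℂ)^c‖ = u ^ c.re :=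
  Complex.norm_cpow_eq_rpow_re_of_pos hu c

lemma piece_bound {s : ℂ} (h0 : 0 < s.re) (k : ℕ) :
    ‖∫ u in ((k+1:ℕ):ℝ)..((k+1:ℕ):ℝ)+1, fr u * (u:ℂ)^(-s-1)‖ ≤
      2 * ‖s‖^(-(s.re/2)) * ((k+1:ℕ):ℝ)^(-(1+s.re/2)) ∨ 1 < s.re := by
  by_cases hs1 : 1 < s.re
  · exact Or.inr hs1
  left
  push Not at hs1
  set P := ∫ u in ((k+1:ℕ):ℝ)..((k+1:ℕ):ℝ)+1, fr u * (u:ℂ)^(-s-1) with hP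
  set n : ℝ := ((k+1:ℕ):ℝ) with hn
  have hn0 : 0 < n := by rw [hn]; positivity
  have hspos : 0 < ‖s‖ := by
    rw [norm_pos_iff]; rintro rfl; simp at h0
  have b1 : ‖P‖ ≤ n ^ (-s.re-1) := by
    have := intervalIntegral.norm_integral_le_of_norm_le_const (a := n) (b := n+1) (C := n ^ (-s.re-1))
      (f := fun u : ℝ => fr u * (u:ℂ)^(-s-1)) (by
        intro u hu
        rw [uIoc_of_le (by linarith)] at hu
        have hu0 : 0 < u := hn0.trans hu.1
        rw [norm_mul, norm_cpow_real hu0]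
        calc _ ≤ 1 * u ^ (-s-1).re := by gcongr; exact fr_norm u
          _ = u ^ (-s.re-1) := by simp
          _ ≤ n ^ (-s.re-1) := Real.rpow_le_rpow_of_nonpos hn0 hu.1.le (by linarith))
    simpa using this
  have b2 : ‖s‖ * ‖P‖ ≤ 2 * n ^ (-s.re) := by
    have sub : Icc n (n+1) ⊆ Ioi 0 := fun x hx => lt_of_lt_of_le hn0 hx.1
    have := fr_ibp (k+1) (fun u : ℝ => (u:ℂ)^(-s)) (fun u : ℝ => -s * (u:ℂ)^(-s-1))
      ((cont_cpow _).mono sub) (fun u hu => hasDeriv_cpow_neg s (hn0.trans hu.1))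
      (((cont_cpow _).mono sub).const_mul _)
    have e : ∫ u in ((k+1:ℕ):ℝ)..((k+1:ℕ):ℝ)+1, fr u * (-s * (u:ℂ)^(-s-1)) = -s * P := by
      rw [hP, ← intervalIntegral.integral_const_mul]
      congr 1; ext u; ring
    rw [e] at this
    have h3 := congrArg norm this
    rw [norm_mul, norm_neg] at h3
    rw [h3]
    refine (norm_sub_le _ _).trans ?_
    have c1 : ‖((((k+1:ℕ):ℝ)+1 : ℝ):ℂ)^(-s)‖ ≤ n ^ (-s.re) := by
      rw [norm_cpow_real (by positivity)]
      exact Real.rpow_le_rpow_of_nonpos hn0 (by linarith) (by simp; linarith)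
    have c2 : ‖∫ u in n..n+1, (u:ℂ)^(-s)‖ ≤ n ^ (-s.re) := by
      have := intervalIntegral.norm_integral_le_of_norm_le_const (a := n) (b := n+1) (C := n ^ (-s.re))
        (f := fun u : ℝ => (u:ℂ)^(-s)) (by
        intro u hu
        rw [uIoc_of_le (by linarith)] at hu
        have hu0 : 0 < u := hn0.trans hu.1
        rw [norm_cpow_real hu0]
        exact Real.rpow_le_rpow_of_nonpos hn0 hu.1.le (by simp; linarith))
      simpa using this
    linarith
  have b2' : ‖P‖ ≤ 2 * n ^ (-s.re) * ‖s‖⁻¹ := by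
    rw [← div_eq_mul_inv, le_div_iff₀ hspos]; linarith
  set θ := s.re/2 with hθ
  have hP0 := norm_nonneg P
  calc ‖P‖ = ‖P‖^θ * ‖P‖^(1-θ) := by
        rw [← Real.rpow_add_of_nonneg hP0 (by positivity) (by linarith)]
        simp
    _ ≤ (2 * n ^ (-s.re) * ‖s‖⁻¹)^θ * (n ^ (-s.re-1))^(1-θ) := by
        gcongr
        linarith
    _ = 2^θ * ‖s‖^(-θ) * n^(-(1+θ)) := by
        rw [Real.mul_rpow (by positivity) (by positivity), Real.mul_rpow (by positivity) (by positivity),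
          Real.inv_rpow hspos.le, ← Real.rpow_neg hspos.le, ← Real.rpow_mul hn0.le, ← Real.rpow_mul hn0.le]
        have : n ^ (-(1+θ)) = n ^ (-s.re*θ) * n ^ ((-s.re-1)*(1-θ)) := by
          rw [← Real.rpow_add hn0]; congr 1; rw [hθ]; ring
        rw [this]; ring
    _ ≤ 2 * ‖s‖^(-θ) * n^(-(1+θ)) := by
        gcongr
        calc (2:ℝ)^θ ≤ 2^(1:ℝ) := Real.rpow_le_rpow_of_exponent_le (by norm_num) (by linarith)
          _ = 2 := by simp

lemma Jf_bound (σ : ℝ) (h0 : 0 < σ) (h1 : σ < 1) :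
    ∃ C : ℝ, 0 ≤ C ∧ ∀ s : ℂ, s.re = σ → ‖Jf s‖ ≤ C * ‖s‖^(-(σ/2)) := by
  have hsum : Summable fun k : ℕ => ((k+1:ℕ):ℝ)^(-(1+σ/2)) :=
    (summable_nat_add_iff 1).mpr (Real.summable_nat_rpow.mpr (by linarith))
  refine ⟨2 * ∑' k : ℕ, ((k+1:ℕ):ℝ)^(-(1+σ/2)), by positivity, ?_⟩
  intro s hs
  have hs0 : 0 < s.re := by rw [hs]; exact h0
  have hi := fr_int_Ioi1 hs0
  have hT : Tendsto (fun N : ℕ => ((N + 1 : ℕ):ℝ)) atTop atTop := 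
    tendsto_natCast_atTop_atTop.comp (tendsto_add_atTop_nat 1)
  have lim := (intervalIntegral_tendsto_integral_Ioi (1:ℝ) hi hT).norm
  refine le_of_tendsto lim (Eventually.of_forall fun N => ?_)
  have hadd := intervalIntegral.sum_integral_adjacent_intervals (μ := volume) 
    (f := fun u : ℝ => fr u * (u:ℂ)^(-s-1)) (a := fun k : ℕ => ((k+1:ℕ):ℝ)) (n := N) (by
      intro k hk
      refine ⟨hi.mono_set ?_, hi.mono_set ?_⟩
      · intro x hx
        refine lt_of_le_of_lt ?_ hx.1
        push_cast; linarith [(Nat.cast_nonneg k : (0:ℝ) ≤ k)]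
      · intro x hx
        refine lt_of_le_of_lt ?_ hx.1
        push_cast; linarith [(Nat.cast_nonneg k : (0:ℝ) ≤ k)])
  simp only [zero_add, Nat.cast_one] at hadd
  rw [← hadd]
  refine (norm_sum_le _ _).trans ?_
  calc _ ≤ ∑ k ∈ Finset.range N, 2 * ‖s‖^(-(σ/2)) * ((k+1:ℕ):ℝ)^(-(1+σ/2)) := by
        refine Finset.sum_le_sum fun k hk => ?_
        rcases piece_bound hs0 k with h | h
        · rw [hs] at h
          rw [Nat.cast_succ (k+1)]
          exact h
        · linarith
    _ = 2 * ‖s‖^(-(σ/2)) * ∑ k ∈ Finset.range N, ((k+1:ℕ):ℝ)^(-(1+σ/2)) := by rw [Finset.mul_sum]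
    _ ≤ 2 * ‖s‖^(-(σ/2)) * ∑' k : ℕ, ((k+1:ℕ):ℝ)^(-(1+σ/2)) := by
        gcongr
        exact hsum.sum_le_tsum _ (fun _ _ => by positivity)
    _ = _ := by ring

/-- Mellin package: convergence and differentiability -/
lemma bot_bigO {g : ℝ → ℂ} (hg : ContinuousOn g (Ici 0)) : g =O[𝓝[>] 0] (fun x : ℝ => x ^ (-(0:ℝ))) := by
  have : Tendsto g (𝓝[>] 0) (𝓝 (g 0)) := (hg 0 (by simp)).mono_left (nhdsWithin_mono _ Ioi_subset_Ici_self)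
  simpa using this.isBigO_one ℝ

lemma locint {g : ℝ → ℂ} (hg : ContinuousOn g (Ici 0)) : LocallyIntegrableOn g (Ioi 0) :=
  (hg.mono Ioi_subset_Ici_self).locallyIntegrableOn measurableSet_Ioi

lemma conv_nice {a : ℝ} {g : ℝ → ℂ} (hg : ContinuousOn g (Ici 0)) 
    (ho : g =O[atTop] fun x : ℝ => x ^ (-a)) {s : ℂ} (h0 : 0 < s.re) (h1 : s.re < a) :
    MellinConvergent g s :=
  mellinConvergent_of_isBigO_rpow (locint hg) ho h1 (bot_bigO hg) h0

lemma diff_nice {a : ℝ} {g : ℝ → ℂ} (hg : ContinuousOn g (Ici 0)) 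
    (ho : g =O[atTop] fun x : ℝ => x ^ (-a)) {s : ℂ} (h0 : 0 < s.re) (h1 : s.re < a) :
    DifferentiableAt ℂ (mellin g) s :=
  mellin_differentiableAt_of_isBigO_rpow (locint hg) ho h1 (bot_bigO hg) h0

lemma mellin_ibp {a : ℝ} {g g' : ℝ → ℂ} (hg : ContinuousOn g (Ici 0)) (hg' : ContinuousOn g' (Ici 0))
    (hd : ∀ x ∈ Ioi (0:ℝ), HasDerivAt g (g' x) x)
    (ho : g =O[atTop] fun x : ℝ => x ^ (-a)) (ho' : g' =O[atTop] fun x : ℝ => x ^ (-(a+1)))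
    {s : ℂ} (h0 : 0 < s.re) (h1 : s.re < a) :
    mellin g s = - s⁻¹ * mellin g' (s+1) := by
  have hs : s ≠ 0 := by rintro rfl; simp at h0
  have c1 := conv_nice hg ho h0 h1
  have c2 := conv_nice hg' ho' (s := s+1) (by simp; linarith) (by simp; linarith)
  unfold MellinConvergent at c1 c2
  simp only [add_sub_cancel_right, smul_eq_mul] at c1 c2
  have hz : Tendsto (fun x : ℝ => (x:ℂ)^s) (𝓝[>] 0) (𝓝 0) := by
    have : ContinuousAt (fun x : ℝ => (x:ℂ)^s) 0 := by
      exact (Complex.continuousAt_ofReal_cpow_const 0 s (Or.inl h0))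
    have t := this.tendsto.mono_left (nhdsWithin_le_nhds (s := Ioi 0))
    simpa [Complex.zero_cpow hs] using t
  have hg0 : Tendsto g (𝓝[>] 0) (𝓝 (g 0)) := (hg 0 (by simp)).mono_left (nhdsWithin_mono _ Ioi_subset_Ici_self)
  have key := integral_Ioi_mul_deriv_eq_deriv_mul (a := (0:ℝ)) (a' := (0:ℂ)) (b' := (0:ℂ))
    (u := fun x : ℝ => s⁻¹ * (x:ℂ)^s) (u' := fun x : ℝ => (x:ℂ)^(s-1)) (v := g) (v' := g')
    (by
      intro x hx
      have := (hasDeriv_cpow_neg (-s) hx).const_mul s⁻¹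
      simp only [neg_neg] at this
      rwa [← mul_assoc, inv_mul_cancel₀ hs, one_mul] at this)
    hd 
    (by
      have := c2.const_mul s⁻¹
      refine this.congr (ae_of_all _ fun x => ?_)
      simp [mul_assoc])
    c1
    (by
      have := (hz.mul hg0).const_mul s⁻¹
      simp only [zero_mul, mul_zero] at this
      refine this.congr fun x => ?_
      simp [mul_assoc])
    (by
      have o1 : (fun x : ℝ => (x:ℂ)^s) =O[atTop] fun x : ℝ => x ^ s.re := by
        refine IsBigO.of_bound 1 ?_
        filter_upwards [eventually_gt_atTop 0] with x hx
        rw [norm_cpow_real hx, one_mul]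
        exact le_abs_self _
      have o2 := (o1.mul ho).const_mul_left s⁻¹
      have : Tendsto (fun x : ℝ => x ^ s.re * x ^ (-a)) atTop (𝓝 0) := by
        have := tendsto_rpow_neg_atTop (y := a - s.re) (by linarith)
        refine this.congr' ?_
        filter_upwards [eventually_gt_atTop 0] with x hx
        rw [← Real.rpow_add hx]; congr 1; ring
      refine (o2.trans_tendsto this).congr fun x => ?_
      simp [mul_assoc])
  unfold mellin
  simp only [add_sub_cancel_right, smul_eq_mul]
  rw [← integral_const_mul]
  have e : ∫ x in Ioi (0:ℝ), -s⁻¹ * ((x:ℂ)^s * g' x) = -∫ x in Ioi (0:ℝ), s⁻¹ * (x:ℂ)^s * g' x := by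
    rw [← integral_neg]; congr 1; ext x; ring
  rw [e, key]
  simp

lemma global_bound {a : ℝ} (ha : 0 ≤ a) {g : ℝ → ℂ} (hg : ContinuousOn g (Ici 0)) 
    (ho : g =O[atTop] fun x : ℝ => x ^ (-a)) : ∃ C : ℝ, 0 ≤ C ∧ ∀ y : ℝ, 0 < y → ‖g y‖ ≤ C * y ^ (-a) := by
  obtain ⟨c, hc⟩ := ho.bound
  obtain ⟨y0, hy0⟩ := eventually_atTop.mp hc
  set y1 := max y0 1
  have hy1 : 0 < y1 := lt_of_lt_of_le one_pos (le_max_right _ _)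
  obtain ⟨B, hB⟩ := (isCompact_Icc (a := (0:ℝ)) (b := y1)).exists_bound_of_continuousOn 
    (hg.mono Icc_subset_Ici_self)
  refine ⟨|c| + |B| * y1 ^ a, by positivity, fun y hy => ?_⟩
  rcases le_total y y1 with h | h
  · calc ‖g y‖ ≤ |B| := (hB y ⟨hy.le, h⟩).trans (le_abs_self _)
      _ = |B| * y1 ^ a * y1 ^ (-a) := by rw [mul_assoc, ← Real.rpow_add hy1]; simp
      _ ≤ |B| * y1 ^ a * y ^ (-a) := by
          gcongr ?_ * ?_
          exact Real.rpow_le_rpow_of_nonpos hy h (by linarith)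
      _ ≤ _ := by
          have : 0 ≤ |c| * y ^ (-a) := by positivity
          linarith
  · calc ‖g y‖ ≤ c * ‖y ^ (-a)‖ := hy0 y ((le_max_left _ _).trans h)
      _ ≤ |c| * y ^ (-a) := by
          rw [Real.norm_of_nonneg (by positivity)]
          gcongr; exact le_abs_self _
      _ ≤ _ := by
          have : 0 ≤ |B| * y1 ^ a * y ^ (-a) := by positivity
          linarith

lemma fubini_int {h : ℝ → ℂ} (hh : ContinuousOn h (Ioi 0)) {s : ℂ} (h0 : 0 < s.re) (h1 : s.re < 1)
    (hc : MellinConvergent h (s+1)) :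
    Integrable (fun p : ℝ × ℝ => (p.1:ℂ)^s * (fr p.2 * h (p.2 * p.1)))
      ((volume.restrict (Ioi 0)).prod (volume.restrict (Ioi 0))) := by
  have hm : AEStronglyMeasurable (fun p : ℝ × ℝ => (p.1:ℂ)^s * (fr p.2 * h (p.2 * p.1)))
      ((volume.restrict (Ioi 0)).prod (volume.restrict (Ioi 0))) := by
    have m1 : AEStronglyMeasurable (fun p : ℝ × ℝ => (p.1:ℂ)^s)
        ((volume.restrict (Ioi (0:ℝ))).prod (volume.restrict (Ioi (0:ℝ)))) := by
      rw [Measure.prod_restrict]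
      refine ContinuousOn.aestronglyMeasurable ?_ (measurableSet_Ioi.prod measurableSet_Ioi)
      exact (cont_cpow s).comp continuousOn_fst (fun p hp => hp.1)
    have m2 : AEStronglyMeasurable (fun p : ℝ × ℝ => h (p.2 * p.1))
        ((volume.restrict (Ioi (0:ℝ))).prod (volume.restrict (Ioi (0:ℝ)))) := by
      rw [Measure.prod_restrict]
      refine ContinuousOn.aestronglyMeasurable ?_ (measurableSet_Ioi.prod measurableSet_Ioi)
      refine hh.comp (by fun_prop) (fun p hp => ?_)
      exact mul_pos (mem_Ioi.mp hp.2) (mem_Ioi.mp hp.1)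
    exact m1.mul (((fr_meas.comp measurable_snd).aestronglyMeasurable).mul m2)
  rw [integrable_prod_iff' hm]
  constructor
  · refine (ae_restrict_iff' measurableSet_Ioi).mpr (ae_of_all _ fun u hu => ?_)
    have := (MellinConvergent.comp_mul_left (f := h) (s := s+1) (a := u) hu).mpr hc
    unfold MellinConvergent at this
    simp only [add_sub_cancel_right, smul_eq_mul] at this
    refine (this.const_mul (fr u)).congr (ae_of_all _ fun x => ?_)
    simp only; ring
  · have hK := (fr_int h0 h1).norm.mul_const (∫ x in Ioi (0:ℝ), ‖(x:ℂ)^s * h x‖)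
    refine hK.congr ((ae_restrict_iff' measurableSet_Ioi).mpr (ae_of_all _ fun u hu => ?_))
    have hu : 0 < u := hu
    have hs := integral_comp_mul_left_Ioi (fun x : ℝ => ‖(x:ℂ)^s * h x‖) 0 hu
    rw [mul_zero] at hs
    have e : ∀ x ∈ Ioi (0:ℝ), ‖(x:ℂ)^s * (fr u * h (u * x))‖ =
        ‖fr u‖ * u ^ (-s.re) * ‖((u * x : ℝ):ℂ)^s * h (u*x)‖ := by
      intro x hx
      have hx : 0 < x := hx
      simp only [norm_mul]
      rw [norm_cpow_real hx, norm_cpow_real (mul_pos hu hx), Real.mul_rpow hu.le hx.le, Real.rpow_neg hu.le]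
      have : u ^ s.re ≠ 0 := (Real.rpow_pos_of_pos hu _).ne'
      field_simp
    simp only
    rw [setIntegral_congr_fun measurableSet_Ioi e, integral_const_mul, hs, norm_mul, norm_cpow_real hu,
      smul_eq_mul]
    have : u ^ (-s-1).re = u ^ (-s.re) * u⁻¹ := by
      rw [← Real.rpow_neg_one, ← Real.rpow_add hu]; simp [sub_eq_add_neg]
    rw [this]; ring

lemma fubini_eq {h : ℝ → ℂ} (hh : ContinuousOn h (Ioi 0)) {s : ℂ} (h0 : 0 < s.re) (h1 : s.re < 1)
    (hc : MellinConvergent h (s+1)) :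
    ∫ x in Ioi (0:ℝ), ∫ u in Ioi (0:ℝ), (x:ℂ)^s * (fr u * h (u * x)) = Kf s * mellin h (s+1) := by
  rw [integral_integral_swap (f := fun x u : ℝ => (x:ℂ)^s * (fr u * h (u * x))) (fubini_int hh h0 h1 hc),
    Kf, ← integral_mul_const]
  refine setIntegral_congr_fun measurableSet_Ioi fun u hu => ?_
  have := mellin_comp_mul_left h (s+1) (a := u) hu
  rw [show -s-1 = -(s+1) by ring, mul_assoc, ← smul_eq_mul ((u:ℂ)^(-(s+1))), ← this, mellin, ← integral_const_mul]
  congr 1; ext x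
  simp; ring

lemma theta_eq {α : ℝ} (hα : 1 < α) {f f' : ℝ → ℂ} (hf : ContinuousOn f (Ici 0)) (hf' : ContinuousOn f' (Ici 0))
    (hd : ∀ x ∈ Ioi (0:ℝ), HasDerivAt f (f' x) x)
    (ho : f =O[atTop] fun x : ℝ => x ^ (-α)) (ho' : f' =O[atTop] fun x : ℝ => x ^ (-(α+1)))
    (h1 : (∫ y in Ioi (0:ℝ), f y) = 0) {x : ℝ} (hx : 0 < x) :
    thetaOp f x = ∫ u in Ioi (0:ℝ), fr u * (x * f' (u * x)) := by
  have maps : MapsTo (fun u : ℝ => u * x) (Ici ((0:ℕ):ℝ)) (Ici 0) := by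
    intro u hu
    simp at hu ⊢; positivity
  have I1 : ∀ {a : ℝ} {g : ℝ → ℂ}, 1 < a → ContinuousOn g (Ici 0) → (g =O[atTop] fun x : ℝ => x ^ (-a)) → 
      IntegrableOn (fun u => g (u * x)) (Ioi 0) := by
    intro a g ha hg hog
    have := conv_nice hg hog (s := 1) (by simp) (by simpa using ha)
    have h2 : IntegrableOn g (Ioi 0) := by simpa [MellinConvergent] using this
    have := (integrableOn_Ioi_comp_mul_right_iff g 0 hx).mpr (by simpa using h2)
    exact this
  have main := fr_sum 0 (fun u : ℝ => f (u * x)) (fun u : ℝ => x * f' (u * x))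
    (hf.comp (by fun_prop) maps) (by
      intro u hu
      have hu : 0 < u := by simpa using hu
      have := (hd (u*x) (mul_pos hu hx)).scomp u ((hasDerivAt_id u).mul_const x)
      simp only [one_mul, Complex.real_smul] at this
      exact this)
    ((hf'.comp (by fun_prop) maps).const_mul _) (by simpa using I1 hα hf ho)
    (by rw [Nat.cast_zero]; exact (I1 (a := α + 1) (by linarith) hf' ho').const_mul (x:ℂ)) (by
      obtain ⟨C, hC, hb⟩ := global_bound (by linarith) hf ho
      have hs : Summable fun k : ℕ => ((k+1:ℕ):ℝ)^(-α) :=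
        (summable_nat_add_iff 1).mpr (Real.summable_nat_rpow.mpr (by linarith))
      refine Summable.of_norm_bounded ((hs.mul_right (x ^ (-α))).mul_left C) fun k => ?_
      refine (hb _ (by positivity)).trans (le_of_eq ?_)
      rw [Real.mul_rpow (by positivity) hx.le]
      simp)
  have e : ∫ u in Ioi ((0:ℕ):ℝ), f (u * x) = 0 := by
    have := integral_comp_mul_right_Ioi f 0 hx
    rw [zero_mul, h1, smul_zero] at this
    simpa using this
  rw [e, add_zero] at main
  simp only [Nat.cast_zero, zero_add] at main
  exact main

lemma theta_cont {α : ℝ} (hα : 1 < α) {f : ℝ → ℂ} (hf : ContinuousOn f (Ici 0))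
    (ho : f =O[atTop] fun x : ℝ => x ^ (-α)) {x : ℝ} (hx : 0 < x) :
    ContinuousAt (thetaOp f) x := by
  obtain ⟨C, hC, hb⟩ := global_bound (by linarith) hf ho
  have hs : Summable fun k : ℕ => ((k+1:ℕ):ℝ)^(-α) :=
    (summable_nat_add_iff 1).mpr (Real.summable_nat_rpow.mpr (by linarith))
  have hc : ContinuousOn (thetaOp f) (Ioi (x/2)) := by
    refine continuousOn_tsum (u := fun k : ℕ => C * (((k+1:ℕ):ℝ)^(-α) * (x/2) ^ (-α))) ?_ 
      ((hs.mul_right _).mul_left C) ?_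
    · intro k
      refine hf.comp (by fun_prop) fun y hy => ?_
      have : x/2 < y := hy
      have : 0 < y := by linarith
      simp only [mem_Ici]; positivity
    · intro k y hy
      have hy : x/2 < y := hy
      have hy0 : 0 < y := by linarith
      refine (hb _ (by positivity)).trans ?_
      rw [Real.mul_rpow (by positivity) hy0.le]
      push_cast
      gcongr C * (?_ * ?_)
      exact Real.rpow_le_rpow_of_nonpos (by linarith) hy.le (by linarith)
  exact hc.continuousAt (Ioi_mem_nhds (by linarith))

lemma iter_facts {α : ℝ} {f : ℝ → ℂ} (hf : MuntzClass α f) : ∃ f' f'' : ℝ → ℂ,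
    ContinuousOn f (Ici 0) ∧ ContinuousOn f' (Ici 0) ∧ ContinuousOn f'' (Ici 0) ∧
    (∀ x ∈ Ioi (0:ℝ), HasDerivAt f (f' x) x) ∧ (∀ x ∈ Ioi (0:ℝ), HasDerivAt f' (f'' x) x) ∧
    (f =O[atTop] fun x : ℝ => x ^ (-α)) ∧ (f' =O[atTop] fun x : ℝ => x ^ (-(α+1))) ∧
    (f'' =O[atTop] fun x : ℝ => x ^ (-(α+1+1))) := by
  obtain ⟨hc, ho⟩ := hf
  have hu := uniqueDiffOn_Ici (0:ℝ)
  have nb : ∀ x ∈ Ioi (0:ℝ), Ici (0:ℝ) ∈ 𝓝 x := fun x hx => Ici_mem_nhds hx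
  have step : ∀ j : ℕ, j < 2 → ∀ x ∈ Ioi (0:ℝ), 
      HasDerivAt (iteratedDerivWithin j f (Ici 0)) (iteratedDerivWithin (j+1) f (Ici 0) x) x := by
    intro j hj x hx
    have d := hc.differentiableOn_iteratedDerivWithin (m := j) (by exact_mod_cast hj) hu x (Ioi_subset_Ici_self hx)
    have := d.hasDerivWithinAt.hasDerivAt (nb x hx)
    rwa [iteratedDerivWithin_succ]
  refine ⟨iteratedDerivWithin 1 f (Ici 0), iteratedDerivWithin 2 f (Ici 0), hc.continuousOn,
    hc.continuousOn_iteratedDerivWithin (by norm_num) hu, hc.continuousOn_iteratedDerivWithin (by norm_num) hu,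
    ?_, step 1 (by norm_num), ?_, ?_, ?_⟩
  · have := step 0 (by norm_num)
    simpa only [iteratedDerivWithin_zero] using this
  · simpa only [iteratedDerivWithin_zero, Nat.cast_zero, add_zero] using ho 0 (by norm_num)
  · simpa using ho 1 (by norm_num)
  · have := ho 2 (by norm_num)
    rw [show α + 1 + 1 = α + (2:ℕ) by push_cast; ring]
    exact this

lemma norm_line_ge (a t : ℝ) (ha : 0 < a) (ha1 : a ≤ 1) : a * (1+t^2)^(1/2:ℝ) ≤ ‖((a:ℂ) + t * Complex.I)‖ := by
  rw [Complex.norm_add_mul_I, ← Real.sqrt_eq_rpow]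
  refine Real.le_sqrt_of_sq_le ?_
  rw [mul_pow, Real.sq_sqrt (by positivity)]
  nlinarith [sq_nonneg t, mul_nonneg (sub_nonneg.mpr ha1) (sq_nonneg t), mul_pos ha ha, mul_nonneg ha.le (mul_nonneg (sub_nonneg.mpr ha1) (sq_nonneg t))]

lemma Kf_bound (σ : ℝ) (h0 : 0 < σ) (h1 : σ < 1) :
    ∃ C : ℝ, 0 ≤ C ∧ ∀ t : ℝ, ‖Kf (σ + t * Complex.I)‖ ≤ C * ((1+t^2)^(1/2:ℝ))^(-(σ/2)) := by
  obtain ⟨C, hC, hJ⟩ := Jf_bound σ h0 h1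
  refine ⟨(1-σ)⁻¹ + C * σ^(-(σ/2)), by have : 0 < 1 - σ := by linarith
                                       positivity, fun t => ?_⟩
  set s : ℂ := σ + t * Complex.I with hs
  have hre : s.re = σ := by simp [hs]
  rw [Kf_eq (by rw [hre]; exact h0) (by rw [hre]; exact h1)]
  set w := (1+t^2)^(1/2:ℝ) with hw
  have hw1 : 1 ≤ w := Real.one_le_rpow (by nlinarith [sq_nonneg t]) (by norm_num)
  have hw0 : 0 < w := by linarith
  have b1 : ‖(1-s)⁻¹‖ ≤ (1-σ)⁻¹ * w ^ (-(σ/2)) := by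
    have := norm_line_ge (1-σ) (-t) (by linarith) (by linarith)
    rw [neg_sq, ← hw] at this
    have e : 1 - s = ((1-σ:ℝ):ℂ) + ((-t:ℝ):ℂ) * Complex.I := by rw [hs]; push_cast; ring
    rw [norm_inv, e]
    have hp : 0 < (1-σ) * w := mul_pos (by linarith) hw0
    calc _ ≤ ((1-σ) * w)⁻¹ := by gcongr
      _ = (1-σ)⁻¹ * w ^ (-1:ℝ) := by rw [mul_inv, Real.rpow_neg_one]
      _ ≤ _ := by
        have : 0 < 1 - σ := by linarith
        gcongr
        linarith
  have b2 : ‖Jf s‖ ≤ C * σ^(-(σ/2)) * w ^ (-(σ/2)) := by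
    refine (hJ s hre).trans ?_
    have := norm_line_ge σ t h0 h1.le
    rw [← hw, ← hs] at this
    rw [mul_assoc, ← Real.mul_rpow h0.le hw0.le]
    gcongr C * ?_
    exact Real.rpow_le_rpow_of_nonpos (by positivity) this (by linarith)
  calc _ ≤ _ := norm_add_le _ _
    _ ≤ _ := add_le_add b1 b2
    _ = _ := by ring

lemma mellin_norm_le (g : ℝ → ℂ) (s : ℂ) : 
    ‖mellin g s‖ ≤ ∫ x in Ioi (0:ℝ), x ^ (s.re - 1) * ‖g x‖ := by
  refine (norm_integral_le_integral_norm _).trans (le_of_eq ?_)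
  refine setIntegral_congr_fun measurableSet_Ioi fun x hx => ?_
  simp only [smul_eq_mul, norm_mul]
  rw [norm_cpow_real hx]; simp

theorem main_repr (α : ℝ) (hα : 1 < α) (f : ℝ → ℂ)
    (hf : MuntzClass α f) (h1' : (∫ y in Ioi (0:ℝ), f y) = 0) (x : ℝ) (hx : 0 < x) (σ : ℝ)
    (h0 : 0 < σ) (h1 : σ < 1) :
      thetaOp f x =
        lineIntegral (fun s => riemannZeta s * mellinT f s * (x : ℂ) ^ (-s)) σ := by
  obtain ⟨f', f'', c0, c1, c2, d0, d1, o0, o1, o2⟩ := iter_facts hf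
  have hT : ∀ s, mellinT f s = mellin f s := fun s => rfl
  have conv1 : ∀ s : ℂ, s.re = σ → MellinConvergent f' (s+1) := fun s hs =>
    conv_nice c1 o1 (by simp; linarith) (by simp; linarith)
  have ibp1 : ∀ s : ℂ, s.re = σ → mellin f s = -s⁻¹ * mellin f' (s+1) := fun s hs => 
    mellin_ibp c0 c1 d0 o0 o1 (by linarith) (by linarith)
  have ibp2 : ∀ s : ℂ, s.re = σ → mellin f' (s+1) = -(s+1)⁻¹ * mellin f'' (s+1+1) := fun s hs => 
    mellin_ibp c1 c2 d1 o1 o2 (by simp; linarith) (by simp; linarith)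
  have hint : ∀ s : ℂ, ∀ y ∈ Ioi (0:ℝ), (y:ℂ)^(s-1) • thetaOp f y = 
      ∫ u in Ioi (0:ℝ), (y:ℂ)^s * (fr u * f' (u * y)) := by
    intro s y hy
    have hy0 : (y:ℂ) ≠ 0 := by exact_mod_cast (ne_of_gt hy)
    rw [theta_eq hα c0 c1 d0 o0 o1 h1' hy, smul_eq_mul, ← integral_const_mul]
    congr 1; ext u
    rw [Complex.cpow_sub _ _ hy0, Complex.cpow_one]
    field_simp
  have zk : ∀ s : ℂ, s.re = σ → riemannZeta s * mellin f s = Kf s * mellin f' (s+1) := by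
    intro s hs
    have : s ≠ 0 := by rintro rfl; simp at hs; linarith
    rw [ibp1 s hs, zeta_eq (by linarith) (by linarith)]
    field_simp
  have mth : ∀ s : ℂ, s.re = σ → mellin (thetaOp f) s = riemannZeta s * mellin f s := by
    intro s hs
    rw [zk s hs, ← fubini_eq (c1.mono Ioi_subset_Ici_self) (by linarith) (by linarith) (conv1 s hs), mellin]
    exact setIntegral_congr_fun measurableSet_Ioi (hint s)
  have mconv : MellinConvergent (thetaOp f) σ := by
    have := (fubini_int (c1.mono Ioi_subset_Ici_self) (s := σ) (by simpa) (by simpa) 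
      (conv1 σ (by simp))).integral_prod_left
    unfold MellinConvergent
    rw [integrableOn_congr_fun (hint σ) measurableSet_Ioi]
    exact this
  have hre : ∀ t : ℝ, ((σ:ℂ) + t * Complex.I).re = σ := fun t => by simp
  have vert : Complex.VerticalIntegrable (mellin (thetaOp f)) σ := by
    unfold Complex.VerticalIntegrable
    obtain ⟨C, hC, hK⟩ := Kf_bound σ h0 h1
    set D := ∫ x in Ioi (0:ℝ), x ^ (σ + 1 + 1 - 1) * ‖f'' x‖ with hD
    have hD0 : 0 ≤ D := setIntegral_nonneg measurableSet_Ioi fun x hx => by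
      have : 0 < x := hx
      positivity
    have hI := (integrable_rpow_neg_one_add_norm_sq (E := ℝ) (μ := volume) (r := 1 + σ/2) 
      (by simp; linarith)).const_mul (C * D)
    have ee : (fun t : ℝ => mellin (thetaOp f) (σ + t * Complex.I)) = 
        fun t : ℝ => riemannZeta (σ + t * Complex.I) * mellin f (σ + t * Complex.I) := by
      ext t; exact mth _ (hre t)
    rw [ee]
    refine hI.mono' ?_ (ae_of_all _ fun t => ?_)
    · refine Continuous.aestronglyMeasurable ?_
      rw [continuous_iff_continuousAt]
      intro t
      have hl : ContinuousAt (fun t : ℝ => (σ:ℂ) + t * Complex.I) t := by fun_prop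
      have z1 : (σ:ℂ) + t * Complex.I ≠ 1 := by
        intro h
        have := congrArg Complex.re h
        rw [hre] at this; simp at this; linarith
      have a1 := (differentiableAt_riemannZeta z1).continuousAt
      have a2 := (diff_nice c0 o0 (s := (σ:ℂ) + t * Complex.I) (by rw [hre]; exact h0) 
        (by rw [hre]; linarith)).continuousAt
      exact (ContinuousAt.comp (f := fun t : ℝ => (σ:ℂ) + t * Complex.I) a1 hl).mul 
        (ContinuousAt.comp (f := fun t : ℝ => (σ:ℂ) + t * Complex.I) a2 hl)
    · rw [zk _ (hre t), ibp2 _ (hre t)]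
      set s := (σ:ℂ) + t * Complex.I with hs
      set w := (1+t^2)^(1/2:ℝ) with hw
      have hb : (0:ℝ) < 1 + t^2 := by positivity
      have hw0 : 0 < w := Real.rpow_pos_of_pos hb _
      have b1 : ‖s+1‖ ≥ w := by
        have := norm_line_ge 1 t one_pos le_rfl
        rw [one_mul, ← hw] at this
        refine this.trans ?_
        rw [show s + 1 = ((σ+1:ℝ):ℂ) + t * Complex.I by rw [hs]; push_cast; ring,
          Complex.norm_add_mul_I, Complex.norm_add_mul_I]
        apply Real.sqrt_le_sqrt
        nlinarith
      have b2 : ‖mellin f'' (s+1+1)‖ ≤ D := by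
        refine (mellin_norm_le _ _).trans (le_of_eq ?_)
        rw [hD]
        simp [hs]
      rw [norm_mul, norm_mul, norm_neg, norm_inv]
      calc _ ≤ (C * w^(-(σ/2))) * (w⁻¹ * D) := by
            gcongr
            exact hK t
        _ = C * D * (w ^ (-(σ/2)) * w ^ (-1:ℝ)) := by rw [Real.rpow_neg_one]; ring
        _ = _ := by
          rw [← Real.rpow_add hw0, hw, ← Real.rpow_mul hb.le, Real.norm_eq_abs, sq_abs]
          congr 2; ring
  have inv := mellinInv_mellin_eq σ (thetaOp f) hx mconv vert (theta_cont hα c0 o0 hx)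
  rw [← inv, mellinInv, lineIntegral, one_div]
  congr 2
  ext t
  rw [mth _ (hre t), hT, smul_eq_mul]
  ring

/-- line-integral representation of the Möbius transformation when `f*(1) = 0`. -/
theorem moebius_transformation_representation (α : ℝ) (hα : 1 < α) (f : ℝ → ℂ)
    (hf : MuntzClass α f) (h1 : mellinT f 1 = 0) (h1' : (∫ y in Ioi (0:ℝ), f y) = 0) :
    ∀ x : ℝ, 0 < x → ∀ σ : ℝ, 0 < σ → σ < 1 →
      thetaOp f x =
        lineIntegral (fun s => riemannZeta s * mellinT f s * (x : ℂ) ^ (-s)) σ := by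
  intro x hx σ h0 h1s
  exact main_repr α hα f hf h1' x hx σ h0 h1s
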